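/- arXiv:hep-th/0603011 — 3 statements merged into one kernel-verified Lean document; each statement's English description precedes it below -/
import Mathlib

section
/- There is no semisimple real Lie algebra of dimension 7. -/
open scoped TensorProduct
open Module LieAlgebra LieModule LieAlgebra.IsKilling

/-- The complexification of a real Killing Lie algebra is Killing. -/
theorem isKilling_complexification (L : Type) [LieRing L] [LieAlgebra ℝ L] [Module.Finite ℝ L]
    [IsKilling ℝ L] : IsKilling ℂ (ℂ ⊗[ℝ] L) := by
  have hnd := killingForm_nondegenerate ℝ L
  let b := Module.finBasis ℝ L
  have hdet := (LinearMap.BilinForm.nondegenerate_iff_det_ne_zero b).mp hnd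
  have key : (killingForm ℂ (ℂ ⊗[ℝ] L)).Nondegenerate := by
    refine (LinearMap.BilinForm.nondegenerate_iff_det_ne_zero (b.baseChange ℂ)).mpr ?_
    have : LinearMap.BilinForm.toMatrix (b.baseChange ℂ) (killingForm ℂ (ℂ ⊗[ℝ] L)) =
        (algebraMap ℝ ℂ).mapMatrix (LinearMap.BilinForm.toMatrix b (killingForm ℝ L)) := by
      ext i j
      rw [LinearMap.BilinForm.toMatrix_apply]
      simp [killingForm, LinearMap.BilinForm.toMatrix_apply]
    rw [this, ← RingHom.map_det]
    simpa using hdet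
  refine ⟨?_⟩
  rw [← LieSubmodule.toSubmodule_inj]
  rw [LieSubmodule.bot_toSubmodule]
  refine (LieIdeal.coe_killingCompl_top ℂ (ℂ ⊗[ℝ] L)).trans ?_
  exact LinearMap.separatingLeft_iff_ker_eq_bot.mp key.1

section
variable {L : Type} [LieRing L] [LieAlgebra ℂ L] [Module.Finite ℂ L] [IsKilling ℂ L]
  [Nontrivial L] (H : LieSubalgebra ℂ L) [H.IsCartanSubalgebra]

theorem finrank_eq_rank_add_card_root :
    finrank ℂ L = finrank ℂ H + H.root.card := by
  classical
  have hinternal : DirectSum.IsInternal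
      (fun χ : Weight ℂ H L => (genWeightSpace L χ).toSubmodule) :=
    DirectSum.isInternal_submodule_of_iSupIndep_of_iSup_eq_top
      (LieSubmodule.iSupIndep_toSubmodule.mpr <| iSupIndep_genWeightSpace' ℂ H L)
      (LieSubmodule.iSup_toSubmodule_eq_top.mpr <| iSup_genWeightSpace_eq_top' ℂ H L)
  have h1 : finrank ℂ L = ∑ χ : Weight ℂ H L, finrank ℂ (genWeightSpace L χ).toSubmodule := by
    rw [← (LinearEquiv.ofBijective (DirectSum.coeLinearMap _) hinternal).finrank_eq, Module.finrank_directSum]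
  rw [h1, ← Finset.add_sum_erase _ _ (Finset.mem_univ (0 : Weight ℂ H L))]
  congr 1
  · have := rootSpace_zero_eq ℂ L H
    have h2 : (genWeightSpace L (0 : H → ℂ)).toSubmodule = H.toSubmodule := by
      rw [← LieSubalgebra.coe_toLieSubmodule, ← this]
    rw [FunLike.coe_zero, h2]
    rfl
  · have : (Finset.univ.erase (0 : Weight ℂ H L)) = H.root := by
      ext χ
      simp [Weight.IsNonZero, Weight.isZero_iff_eq_zero]
    rw [this, Finset.card_eq_sum_ones]
    refine Finset.sum_congr rfl fun χ hχ => ?_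
    exact finrank_rootSpace_eq_one χ (by simpa using hχ)

theorem exists_card_root : ∃ p, H.root.card = 2 * p ∧ finrank ℂ H ≤ p := by
  classical
  let P := rootSystem H
  obtain ⟨b⟩ := P.nonempty_base
  let := P.indexNeg
  let A : Finset H.root := Finset.univ.filter b.IsPos
  have hcompl : A.card = Aᶜ.card := by
    refine Finset.card_bij (fun i _ => -i) ?_ ?_ ?_
    · intro i hi
      have := RootPairing.Base.IsPos.neg_iff_not b i
      simp_all [A]
    · intro i _ j _ h
      exact neg_injective h
    · intro i hi
      have := RootPairing.Base.IsPos.neg_iff_not b i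
      exact ⟨-i, by simp_all [A], neg_neg i⟩
  refine ⟨A.card, ?_, ?_⟩
  · have := A.card_add_card_compl
    rw [Fintype.card_coe] at this
    omega
  · rw [← Subspace.dual_finrank_eq, finrank_eq_card_basis b.toWeightBasis, Fintype.card_coe]
    refine Finset.card_le_card fun i hi => ?_
    simpa [A] using b.isPos_of_mem_support hi

theorem card_root_le_two (h : finrank ℂ H = 1) : H.root.card ≤ 2 := by
  classical
  rcases H.root.eq_empty_or_nonempty with h0 | ⟨α, hα⟩
  · simp [h0]
  have hα' : α.IsNonZero := by simpa using hα
  have hd : finrank ℂ (Dual ℂ H) = 1 := by rw [Subspace.dual_finrank_eq, h]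
  have hne : α.toLinear ≠ 0 := by
    intro h0
    apply hα'
    funext x
    exact LinearMap.congr_fun h0 x
  have hsub : H.root ⊆ {-α, α} := by
    intro β hβ
    obtain ⟨c, hc⟩ := (finrank_eq_one_iff_of_nonzero' _ hne).mp hd β.toLinear
    have := eq_neg_or_eq_of_eq_smul α β (by simpa using hβ) c (by
      funext x
      exact (LinearMap.congr_fun hc x).symm)
    simpa using this
  exact (Finset.card_le_card hsub).trans Finset.card_le_two

theorem finrank_ne_seven_of_isKilling : finrank ℂ L ≠ 7 := by
  intro h7
  obtain ⟨x, hx⟩ := LieAlgebra.exists_isCartanSubalgebra_engel ℂ L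
  have h1 := finrank_eq_rank_add_card_root (LieSubalgebra.engel ℂ x)
  obtain ⟨p, hp, hr⟩ := exists_card_root (LieSubalgebra.engel ℂ x)
  have h2 := card_root_le_two (LieSubalgebra.engel ℂ x)
  have : finrank ℂ (LieSubalgebra.engel ℂ x) = 1 := by omega
  have := h2 this
  omega
end

/-- There is no semisimple real Lie algebra of dimension 7. -/
theorem no_semisimple_real_lie_algebra_dim_seven
    (L : Type) [LieRing L] [LieAlgebra ℝ L] [Module.Finite ℝ L]
    (h : Module.finrank ℝ L = 7) :
    ¬ LieAlgebra.IsSemisimple ℝ L := by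
  intro hs
  have : IsKilling ℝ L := inferInstance
  have hK := isKilling_complexification L
  have hf : finrank ℂ (ℂ ⊗[ℝ] L) = 7 := by rw [finrank_baseChange, h]
  have : Nontrivial (ℂ ⊗[ℝ] L) := nontrivial_of_finrank_pos (R := ℂ) (by omega)
  exact finrank_ne_seven_of_isKilling hf
end

section
/- There is no semisimple real Lie algebra of dimension 4. -/
open LieAlgebra in
/-- A nonzero vector on which the invariant 3-form vanishes is impossible. -/
lemma eq_zero_of_threeForm_eq_zero
    (L : Type) [LieRing L] [LieAlgebra ℝ L] [Module.Finite ℝ L]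
    [HasTrivialRadical ℝ L] (b : Module.Basis (Fin 4) ℝ L) (v : L)
    (hv : ∀ i j, killingForm ℝ L ⁅v, b i⁆ (b j) = 0) : v = 0 := by
  have h1 : ∀ i, ⁅v, b i⁆ = 0 := by
    intro i
    have h2 : killingForm ℝ L ⁅v, b i⁆ = 0 := b.ext (fun j => by simpa using hv i j)
    have h3 : ⁅v, b i⁆ ∈ LinearMap.ker (killingForm ℝ L) := h2
    rw [IsKilling.ker_killingForm_eq_bot] at h3
    simpa using h3
  have h4 : LieModule.toEnd ℝ L L v = 0 := b.ext (fun i => by simpa using h1 i)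
  have h5 : v ∈ center ℝ L := by
    rw [LieModule.mem_maxTrivSubmodule]
    intro x
    have h6 : ⁅v, x⁆ = 0 := by simpa using LinearMap.congr_fun h4 x
    rw [← lie_skew, h6, neg_zero]
  rw [center_eq_bot] at h5
  simpa using h5

/-- There is no semisimple real Lie algebra of dimension 4. -/
theorem no_semisimple_real_lie_algebra_dim_four
    (L : Type) [LieRing L] [LieAlgebra ℝ L] [Module.Finite ℝ L]
    (h : Module.finrank ℝ L = 4) :
    ¬ LieAlgebra.IsSemisimple ℝ L := by
  intro hs
  let b : Module.Basis (Fin 4) ℝ L := Module.finBasisOfFinrankEq ℝ L h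
  obtain ⟨f, hf⟩ : ∃ f : Fin 4 → Fin 4 → Fin 4 → ℝ,
      ∀ i j k, killingForm ℝ L ⁅b i, b j⁆ (b k) = f i j k := ⟨_, fun _ _ _ => rfl⟩
  have s1 : ∀ i j k, f i j k = - f j i k := by
    intro i j k
    rw [← hf, ← hf, ← lie_skew, map_neg, LinearMap.neg_apply]
  have s2 : ∀ i j k, f i j k = f j k i := by
    intro i j k
    rw [← hf, ← hf, LieModule.traceForm_apply_lie_apply, LieModule.traceForm_comm]
  have s0 : ∀ i k, f i i k = 0 := fun i k => by linarith [s1 i i k]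
  have sm : ∀ i k, f i k i = 0 := fun i k => by rw [← s2 i i k, s0]
  have sr : ∀ i k, f k i i = 0 := fun i k => by rw [s2, s0]
  have t : ∀ p q r, f q r p = f p q r ∧ f r p q = f p q r ∧ f q p r = - f p q r ∧
      f p r q = - f p q r ∧ f r q p = - f p q r := by
    intro p q r
    have h1 := s2 p q r
    have h2 := s2 q r p
    have h3 := s1 q p r
    have h4 := s1 p r q
    have h5 := s1 r q p
    refine ⟨?_, ?_, ?_, ?_, ?_⟩ <;> linarith
  obtain ⟨a1, a2, a3, a4, a5⟩ := t 0 1 2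
  obtain ⟨b1, b2, b3, b4, b5⟩ := t 0 1 3
  obtain ⟨c1, c2, c3, c4, c5⟩ := t 0 2 3
  obtain ⟨d1, d2, d3, d4, d5⟩ := t 1 2 3
  have hv := eq_zero_of_threeForm_eq_zero L b
    (f 1 2 3 • b 0 - f 0 2 3 • b 1 + f 0 1 3 • b 2 - f 0 1 2 • b 3) (by
      intro i j
      simp only [sub_lie, add_lie, smul_lie, map_sub, map_add, map_smul, LinearMap.sub_apply,
        LinearMap.add_apply, LinearMap.smul_apply, hf, smul_eq_mul]
      fin_cases i <;> fin_cases j <;>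
        simp only [Fin.zero_eta, Fin.mk_one, Fin.reduceFinMk, s0, sm, sr, a1, a2, a3, a4, a5,
          b1, b2, b3, b4, b5, c1, c2, c3, c4, c5, d1, d2, d3, d4, d5] <;> ring)
  have hli := b.linearIndependent
  rw [Fintype.linearIndependent_iff] at hli
  have hc := hli ![f 1 2 3, - f 0 2 3, f 0 1 3, - f 0 1 2] (by
    rw [← hv]
    simp [Fin.sum_univ_four, sub_eq_add_neg])
  have z0 : f 1 2 3 = 0 := by simpa using hc 0
  have z1 : f 0 2 3 = 0 := by simpa using hc 1
  have z2 : f 0 1 3 = 0 := by simpa using hc 2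
  have z3 : f 0 1 2 = 0 := by simpa using hc 3
  refine b.ne_zero 0 (eq_zero_of_threeForm_eq_zero L b (b 0) ?_)
  intro i j
  rw [hf]
  fin_cases i <;> fin_cases j <;>
    simp [s0, sm, sr, a4, b4, c4, z1, z2, z3]
end

section
/- Every simple real Lie algebra of dimension 3 is isomorphic either to so(3) or to sl(2,R). -/
/-- `L` has a basis with cyclic structure constants `a₀, a₁, a₂`. -/
def HasCyc (L : Type) [LieRing L] [LieAlgebra ℝ L] (a0 a1 a2 : ℝ) : Prop :=
  ∃ b : Module.Basis (Fin 3) ℝ L,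
    ⁅b 0, b 1⁆ = a2 • b 2 ∧ ⁅b 1, b 2⁆ = a0 • b 0 ∧ ⁅b 2, b 0⁆ = a1 • b 1

theorem HasCyc.equiv {L L' : Type} [LieRing L] [LieAlgebra ℝ L] [LieRing L'] [LieAlgebra ℝ L']
    {a0 a1 a2 : ℝ} (h : HasCyc L a0 a1 a2) (h' : HasCyc L' a0 a1 a2) :
    Nonempty (L ≃ₗ⁅ℝ⁆ L') := by
  obtain ⟨b, h2, h0, h1⟩ := h
  obtain ⟨c, k2, k0, k1⟩ := h'
  let e : L ≃ₗ[ℝ] L' := b.equiv c (Equiv.refl _)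
  have he : ∀ i, e (b i) = c i := fun i => by simp [e]
  have skew : ∀ {M : Type} [LieRing M] (x y z : M), ⁅x, y⁆ = z → ⁅y, x⁆ = -z := by
    intro M _ x y z hz
    rw [← hz, lie_skew]
  have key : ∀ i j, e ⁅b i, b j⁆ = ⁅c i, c j⁆ := by
    intro i j
    fin_cases i <;> fin_cases j <;>
      simp [h0, h1, h2, k0, k1, k2, skew _ _ _ h0, skew _ _ _ h1, skew _ _ _ h2,
        skew _ _ _ k0, skew _ _ _ k1, skew _ _ _ k2, he]
  have : ∀ x y, e ⁅x, y⁆ = ⁅e x, e y⁆ := by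
    intro x y
    rw [← b.sum_repr x, ← b.sum_repr y]
    simp only [Fin.sum_univ_three, add_lie, lie_add, smul_lie, lie_smul, map_add, map_smul, key, he]
  exact ⟨{ e with map_lie' := fun {x y} => this x y }⟩

theorem HasCyc.rot {L : Type} [LieRing L] [LieAlgebra ℝ L]
    {a0 a1 a2 : ℝ} (h : HasCyc L a0 a1 a2) : HasCyc L a1 a2 a0 := by
  obtain ⟨b, h2, h0, h1⟩ := h
  refine ⟨b.reindex (finRotate 3).symm, ?_⟩
  simp only [Module.Basis.reindex_apply, Equiv.symm_symm]
  have r0 : finRotate 3 0 = 1 := by decide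
  have r1 : finRotate 3 1 = 2 := by decide
  have r2 : finRotate 3 2 = 0 := by decide
  rw [r0, r1, r2]
  exact ⟨h0, h1, h2⟩

theorem HasCyc.scale {L : Type} [LieRing L] [LieAlgebra ℝ L]
    {a0 a1 a2 : ℝ} (h : HasCyc L a0 a1 a2) {t0 t1 t2 : ℝ} (h0 : t0 ≠ 0) (h1 : t1 ≠ 0)
    (h2 : t2 ≠ 0) :
    HasCyc L (t1 * t2 / t0 * a0) (t2 * t0 / t1 * a1) (t0 * t1 / t2 * a2) := by
  obtain ⟨b, k2, k0, k1⟩ := h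
  refine ⟨b.isUnitSMul (w := ![t0, t1, t2]) ?_, ?_, ?_, ?_⟩
  · intro i
    fin_cases i <;> simpa
  all_goals
    simp only [Module.Basis.isUnitSMul_apply, smul_lie, lie_smul, k0, k1, k2, smul_smul]
    congr 1
    simp
    field_simp

theorem HasCyc.signs {L : Type} [LieRing L] [LieAlgebra ℝ L]
    {a0 a1 a2 : ℝ} (h : HasCyc L a0 a1 a2) (h0 : a0 ≠ 0) (h1 : a1 ≠ 0) (h2 : a2 ≠ 0) :
    HasCyc L (a0 / |a0|) (a1 / |a1|) (a2 / |a2|) := by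
  have p0 := abs_pos.2 h0
  have p1 := abs_pos.2 h1
  have p2 := abs_pos.2 h2
  have key := h.scale (t0 := (√|a1| * √|a2|)⁻¹) (t1 := (√|a2| * √|a0|)⁻¹)
    (t2 := (√|a0| * √|a1|)⁻¹) (by positivity) (by positivity) (by positivity)
  have s0 := Real.sq_sqrt p0.le
  have s1 := Real.sq_sqrt p1.le
  have s2 := Real.sq_sqrt p2.le
  have q0 := Real.sqrt_pos.2 p0
  have q1 := Real.sqrt_pos.2 p1
  have q2 := Real.sqrt_pos.2 p2
  convert key using 1
  · field_simp; linarith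
  · field_simp; linarith
  · field_simp; linarith

theorem HasCyc.neg {L : Type} [LieRing L] [LieAlgebra ℝ L]
    {a0 a1 a2 : ℝ} (h : HasCyc L a0 a1 a2) : HasCyc L (-a0) (-a1) (-a2) := by
  have := h.scale (t0 := -1) (t1 := -1) (t2 := -1) (by simp) (by simp) (by simp)
  simpa using this

theorem hasCyc_so : HasCyc (LieAlgebra.Orthogonal.so (Fin 3) ℝ) 1 1 1 := by
  let e : (LieAlgebra.Orthogonal.so (Fin 3) ℝ) ≃ₗ[ℝ] (Fin 3 → ℝ) :=
    { toFun := fun A => ![A.1 2 1, A.1 0 2, A.1 1 0]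
      map_add' := by intro A B; ext i; fin_cases i <;> simp
      map_smul' := by intro r A; ext i; fin_cases i <;> simp
      invFun := fun v => ⟨!![0, -v 2, v 1; v 2, 0, -v 0; -v 1, v 0, 0], by
        rw [LieAlgebra.Orthogonal.mem_so]
        ext i j; fin_cases i <;> fin_cases j <;> simp⟩
      left_inv := by
        rintro ⟨A, hA⟩
        rw [LieAlgebra.Orthogonal.mem_so] at hA
        have hA' : ∀ i j, A j i = - A i j := fun i j => by
          simpa using congrFun (congrFun hA i) j
        have d : ∀ i, A i i = 0 := fun i => by linarith [hA' i i]
        ext i j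
        fin_cases i <;> fin_cases j <;> simp [d]
        · linarith [hA' 0 1]
        · linarith [hA' 1 2]
        · linarith [hA' 0 2]
      right_inv := by
        intro v; ext i; fin_cases i <;> simp }
  have hbr : ∀ A B : LieAlgebra.Orthogonal.so (Fin 3) ℝ,
      (⁅A, B⁆).val = A.val * B.val - B.val * A.val := fun _ _ => rfl
  have hsm : ∀ (r : ℝ) (A : LieAlgebra.Orthogonal.so (Fin 3) ℝ),
      (r • A).val = r • A.val := fun _ _ => rfl
  have hes : ∀ v, (e.symm v).val = (e.invFun v).val := fun _ => rfl
  refine ⟨Module.Basis.ofEquivFun e, ?_, ?_, ?_⟩ <;>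
  · simp only [Module.Basis.coe_ofEquivFun]
    apply Subtype.ext
    rw [hbr, hsm]
    simp only [hes, e]
    clear hes hbr hsm e
    ext i j
    fin_cases i <;> fin_cases j <;> simp [Matrix.mul_apply, Fin.sum_univ_three]

theorem hasCyc_sl : HasCyc (LieAlgebra.SpecialLinear.sl (Fin 2) ℝ) (-1) (-1) 1 := by
  have mem : ∀ A : Matrix (Fin 2) (Fin 2) ℝ,
      A ∈ LieAlgebra.SpecialLinear.sl (Fin 2) ℝ ↔ A 0 0 + A 1 1 = 0 := by
    intro A
    rw [← Matrix.trace_fin_two]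
    exact Iff.rfl
  let e : (LieAlgebra.SpecialLinear.sl (Fin 2) ℝ) ≃ₗ[ℝ] (Fin 3 → ℝ) :=
    { toFun := fun A => ![2 * A.1 0 0, A.1 0 1 + A.1 1 0, A.1 0 1 - A.1 1 0]
      map_add' := by intro A B; ext i; fin_cases i <;> simp <;> ring
      map_smul' := by intro r A; ext i; fin_cases i <;> simp <;> ring
      invFun := fun v => ⟨!![v 0 / 2, (v 1 + v 2) / 2; (v 1 - v 2) / 2, - v 0 / 2], by
        rw [mem]; simp; ring⟩
      left_inv := by
        rintro ⟨A, hA⟩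
        rw [mem] at hA
        ext i j
        fin_cases i <;> fin_cases j <;> simp
        linarith
      right_inv := by
        intro v; ext i; fin_cases i <;> simp <;> ring }
  have hbr : ∀ A B : LieAlgebra.SpecialLinear.sl (Fin 2) ℝ,
      (⁅A, B⁆).val = A.val * B.val - B.val * A.val := fun _ _ => rfl
  have hsm : ∀ (r : ℝ) (A : LieAlgebra.SpecialLinear.sl (Fin 2) ℝ),
      (r • A).val = r • A.val := fun _ _ => rfl
  have hes : ∀ v, (e.symm v).val = (e.invFun v).val := fun _ => rfl
  refine ⟨Module.Basis.ofEquivFun e, ?_, ?_, ?_⟩ <;>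
  · simp only [Module.Basis.coe_ofEquivFun]
    apply Subtype.ext
    rw [hbr, hsm]
    simp only [hes, e]
    clear hes hbr hsm e
    ext i j
    fin_cases i <;> fin_cases j <;> simp [Matrix.mul_apply, Fin.sum_univ_two] <;> norm_num

theorem exists_hasCyc (L : Type) [LieRing L] [LieAlgebra ℝ L] [Module.Finite ℝ L]
    (h : Module.finrank ℝ L = 3) (hs : LieAlgebra.IsSimple ℝ L) :
    ∃ a0 a1 a2 : ℝ, a0 ≠ 0 ∧ a1 ≠ 0 ∧ a2 ≠ 0 ∧ HasCyc L a0 a1 a2 := by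
  have nd := LieAlgebra.IsKilling.killingForm_nondegenerate ℝ L
  obtain ⟨b', hb'⟩ := LinearMap.BilinForm.exists_orthogonal_basis
    (B := killingForm ℝ L) (LieModule.traceForm_isSymm ℝ L L)
  have hd' := hb'.not_isOrtho_basis_self_of_separatingLeft nd.1
  let b : Module.Basis (Fin 3) ℝ L := b'.reindex (finCongr h)
  have hd : ∀ i, killingForm ℝ L (b i) (b i) ≠ 0 := fun i => by
    simpa [b] using hd' _
  have ho : ∀ i j, i ≠ j → killingForm ℝ L (b i) (b j) = 0 := fun i j hij => by
    have := hb' (i := (finCongr h).symm i) (j := (finCongr h).symm j) (by simpa using hij)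
    simpa [b] using this
  clear_value b
  have hx : ∀ x y, (∀ i, killingForm ℝ L x (b i) = killingForm ℝ L y (b i)) → x = y := by
    intro x y hxy
    have : killingForm ℝ L x = killingForm ℝ L y := b.ext hxy
    rw [← sub_eq_zero]
    apply nd.1
    intro z
    simp [this]
  have inv : ∀ x y z, killingForm ℝ L ⁅x, y⁆ z = killingForm ℝ L x ⁅y, z⁆ :=
    LieModule.traceForm_apply_lie_apply ℝ L L
  have comm : ∀ x y, killingForm ℝ L x y = killingForm ℝ L y x :=
    LieModule.traceForm_comm ℝ L L
  have z1 : ∀ x y, killingForm ℝ L ⁅x, y⁆ y = 0 := fun x y => by rw [inv]; simp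
  have z2 : ∀ x y, killingForm ℝ L ⁅x, y⁆ x = 0 := fun x y => by rw [comm, ← inv]; simp
  have cyc : ∀ x y z, killingForm ℝ L ⁅x, y⁆ z = killingForm ℝ L ⁅y, z⁆ x := fun x y z => by
    rw [inv, comm]
  set c := killingForm ℝ L ⁅b 0, b 1⁆ (b 2) with hc
  have c0 : killingForm ℝ L ⁅b 1, b 2⁆ (b 0) = c := (cyc _ _ _).symm
  have c1 : killingForm ℝ L ⁅b 2, b 0⁆ (b 1) = c := by rw [← c0, ← cyc]
  have e2 : ⁅b 0, b 1⁆ = (c / killingForm ℝ L (b 2) (b 2)) • b 2 := by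
    have := hd 2
    apply hx
    intro i
    fin_cases i
    · simp [z2, ho]
    · simp [z1, ho]
    · simp [← hc, this]
  have e0 : ⁅b 1, b 2⁆ = (c / killingForm ℝ L (b 0) (b 0)) • b 0 := by
    have := hd 0
    apply hx
    intro i
    fin_cases i
    · simp [c0, this]
    · simp [z2, ho]
    · simp [z1, ho]
  have e1 : ⁅b 2, b 0⁆ = (c / killingForm ℝ L (b 1) (b 1)) • b 1 := by
    have := hd 1
    apply hx
    intro i
    fin_cases i
    · simp [z1, ho]
    · simp [c1, this]
    · simp [z2, ho]
  have hc0 : c ≠ 0 := by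
    intro hc0
    simp only [hc0, zero_div, zero_smul] at e0 e1 e2
    apply hs.non_abelian
    have f0 : ⁅b 2, b 1⁆ = 0 := by rw [← lie_skew, e0, neg_zero]
    have f1 : ⁅b 0, b 2⁆ = 0 := by rw [← lie_skew, e1, neg_zero]
    have f2 : ⁅b 1, b 0⁆ = 0 := by rw [← lie_skew, e2, neg_zero]
    refine ⟨fun x y => ?_⟩
    rw [← b.sum_repr x, ← b.sum_repr y]
    simp only [Fin.sum_univ_three, add_lie, lie_add, smul_lie, lie_smul, lie_self, e0, e1, e2, f0,
      f1, f2, smul_zero, add_zero]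
  exact ⟨_, _, _, div_ne_zero hc0 (hd 0), div_ne_zero hc0 (hd 1), div_ne_zero hc0 (hd 2),
    b, e2, e0, e1⟩


/-- Every simple real Lie algebra of dimension 3 is isomorphic either to
`so(3)` (antisymmetric real 3×3 matrices) or to `sl(2,ℝ)` (traceless real 2×2 matrices). -/
theorem simple_real_lie_algebra_dim_three_classification
    (L : Type) [LieRing L] [LieAlgebra ℝ L] [Module.Finite ℝ L]
    (h : Module.finrank ℝ L = 3) (hs : LieAlgebra.IsSimple ℝ L) :
    Nonempty (L ≃ₗ⁅ℝ⁆ (LieAlgebra.Orthogonal.so (Fin 3) ℝ)) ∨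
      Nonempty (L ≃ₗ⁅ℝ⁆ (LieAlgebra.SpecialLinear.sl (Fin 2) ℝ)) := by
  obtain ⟨a0, a1, a2, h0, h1, h2, H⟩ := exists_hasCyc L h hs
  have K := H.signs h0 h1 h2
  have sg : ∀ a : ℝ, a ≠ 0 → a / |a| = 1 ∨ a / |a| = -1 := by
    intro a ha
    rcases abs_cases a with ⟨h, _⟩ | ⟨h, _⟩ <;> rw [h]
    · left; exact div_self ha
    · right; rw [div_neg, div_self ha]
  rcases sg a0 h0 with s0 | s0 <;> rcases sg a1 h1 with s1 | s1 <;>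
    rcases sg a2 h2 with s2 | s2 <;> rw [s0, s1, s2] at K <;> have K' := K.neg <;>
    try simp only [neg_neg] at K'
  · exact Or.inl (K.equiv hasCyc_so)
  · exact Or.inr (K'.equiv hasCyc_sl)
  · exact Or.inr (K'.rot.rot.equiv hasCyc_sl)
  · exact Or.inr (K.rot.equiv hasCyc_sl)
  · exact Or.inr (K'.rot.equiv hasCyc_sl)
  · exact Or.inr (K.rot.rot.equiv hasCyc_sl)
  · exact Or.inr (K.equiv hasCyc_sl)
  · exact Or.inl (K'.equiv hasCyc_so)
end
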